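/- arXiv:2211.08750 — 6 statements merged into one kernel-verified Lean document; each statement's English description precedes it below -/
import Mathlib

section
/- On ℝ³×ℝ³ with the Dirac bracket {·,·}_S associated with the sphere constraints, the angular momentum components J₁ = x₂p₃ − x₃p₂, J₂ = x₃p₁ − x₁p₃, J₃ = x₁p₂ − x₂p₁ together with the coordinates x₁, x₂, x₃ satisfy, at every point of the constraint surface T*S² (where x₁²+x₂²+x₃² = 1 and x₁p₁+x₂p₂+x₃p₃ = 0), the Lie–Poisson relations of e*(3): {J_i, J_j}_S = ε_{ijk} J_k, {x_i, J_j}_S = ε_{ijk} x_k, and {x_i, x_j}_S = 0 for all i, j (ε_{ijk} the totally antisymmetric symbol). Moreover, at these points C₁ = x₁²+x₂²+x₃² = 1 and C₂ = x₁J₁+x₂J₂+x₃J₃ = 0. -/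
noncomputable section

/-- Phase space T*ℝ³ = ℝ³ × ℝ³ with coordinates (x, p). -/
abbrev Phase : Type := (Fin 3 → ℝ) × (Fin 3 → ℝ)

/-- Canonical Poisson bracket on ℝ³ × ℝ³:
{f,g} = Σᵢ (∂f/∂xᵢ ∂g/∂pᵢ − ∂f/∂pᵢ ∂g/∂xᵢ). -/
noncomputable def pb (f g : Phase → ℝ) (z : Phase) : ℝ :=
  ∑ i : Fin 3,
    (fderiv ℝ f z (Pi.single i 1, 0) * fderiv ℝ g z (0, Pi.single i 1) -
     fderiv ℝ f z (0, Pi.single i 1) * fderiv ℝ g z (Pi.single i 1, 0))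

/-- Dirac bracket associated with constraints F₁, F₂:
{f,g}_D = {f,g} − ({F₁,f}{F₂,g} − {F₁,g}{F₂,f})/{F₁,F₂}. -/
noncomputable def dirac (F₁ F₂ f g : Phase → ℝ) (z : Phase) : ℝ :=
  pb f g z - (pb F₁ f z * pb F₂ g z - pb F₁ g z * pb F₂ f z) / pb F₁ F₂ z
/-- Sphere constraint F₁ = x₁² + x₂² + x₃² − 1. -/
def sphereF₁ : Phase → ℝ := fun z => z.1 0 ^ 2 + z.1 1 ^ 2 + z.1 2 ^ 2 - 1

/-- Sphere constraint F₂ = x₁p₁ + x₂p₂ + x₃p₃. -/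
def sphereF₂ : Phase → ℝ := fun z => z.1 0 * z.2 0 + z.1 1 * z.2 1 + z.1 2 * z.2 2

/-- Sphere Dirac bracket {·,·}_S. -/
noncomputable def diracS (f g : Phase → ℝ) (z : Phase) : ℝ :=
  dirac sphereF₁ sphereF₂ f g z

/-- Angular momentum J₁ = x₂p₃ − x₃p₂. -/
noncomputable def J1 : Phase → ℝ := fun z => z.1 1 * z.2 2 - z.1 2 * z.2 1
/-- Angular momentum J₂ = x₃p₁ − x₁p₃. -/
noncomputable def J2 : Phase → ℝ := fun z => z.1 2 * z.2 0 - z.1 0 * z.2 2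
/-- Angular momentum J₃ = x₁p₂ − x₂p₁. -/
noncomputable def J3 : Phase → ℝ := fun z => z.1 0 * z.2 1 - z.1 1 * z.2 0

/-- Angular momenta as an indexed family. -/
noncomputable def Jv : Fin 3 → Phase → ℝ := ![J1, J2, J3]

/-- Totally antisymmetric Levi-Civita symbol ε_{ijk} on Fin 3. -/
def eps : Fin 3 → Fin 3 → Fin 3 → ℝ := fun i j k =>
  if (i, j, k) = ((0:Fin 3), (1:Fin 3), (2:Fin 3)) ∨
     (i, j, k) = ((1:Fin 3), (2:Fin 3), (0:Fin 3)) ∨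
     (i, j, k) = ((2:Fin 3), (0:Fin 3), (1:Fin 3)) then 1
  else if (i, j, k) = ((2:Fin 3), (1:Fin 3), (0:Fin 3)) ∨
          (i, j, k) = ((1:Fin 3), (0:Fin 3), (2:Fin 3)) ∨
          (i, j, k) = ((0:Fin 3), (2:Fin 3), (1:Fin 3)) then -1
  else 0

lemma hasFDerivAt_position (z : Phase) (i : Fin 3) :
    HasFDerivAt (fun w : Phase => w.1 i)
      ((ContinuousLinearMap.proj i).comp (ContinuousLinearMap.fst ℝ (Fin 3 → ℝ) (Fin 3 → ℝ))) z :=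
  ((ContinuousLinearMap.proj (R := ℝ) (φ := fun _ : Fin 3 => ℝ) i).comp
    (ContinuousLinearMap.fst ℝ (Fin 3 → ℝ) (Fin 3 → ℝ))).hasFDerivAt

lemma hasFDerivAt_momentum (z : Phase) (i : Fin 3) :
    HasFDerivAt (fun w : Phase => w.2 i)
      ((ContinuousLinearMap.proj i).comp (ContinuousLinearMap.snd ℝ (Fin 3 → ℝ) (Fin 3 → ℝ))) z :=
  ((ContinuousLinearMap.proj (R := ℝ) (φ := fun _ : Fin 3 => ℝ) i).comp
    (ContinuousLinearMap.snd ℝ (Fin 3 → ℝ) (Fin 3 → ℝ))).hasFDerivAt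

lemma fderiv_position_apply (z v : Phase) (i : Fin 3) :
    fderiv ℝ (fun w : Phase => w.1 i) z v = v.1 i := by
  rw [(hasFDerivAt_position z i).fderiv]
  rfl

lemma hasFDerivAt_position_mul_momentum (z : Phase) (i j : Fin 3) :
    HasFDerivAt (fun w : Phase => w.1 i * w.2 j)
      (z.1 i • (ContinuousLinearMap.proj j).comp
          (ContinuousLinearMap.snd ℝ (Fin 3 → ℝ) (Fin 3 → ℝ)) +
        z.2 j • (ContinuousLinearMap.proj i).comp
          (ContinuousLinearMap.fst ℝ (Fin 3 → ℝ) (Fin 3 → ℝ))) z :=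
  (hasFDerivAt_position z i).mul (hasFDerivAt_momentum z j)

lemma fderiv_sphereF₁_apply (z v : Phase) :
    fderiv ℝ sphereF₁ z v = 2 * (z.1 0 * v.1 0 + z.1 1 * v.1 1 + z.1 2 * v.1 2) := by
  have h : HasFDerivAt sphereF₁ _ z :=
    ((((hasFDerivAt_position z 0).pow 2).add ((hasFDerivAt_position z 1).pow 2)).add
      ((hasFDerivAt_position z 2).pow 2)).sub_const 1
  rw [h.fderiv]
  simp
  ring

lemma fderiv_J1_apply (z v : Phase) :
    fderiv ℝ J1 z v =
      z.1 1 * v.2 2 + z.2 2 * v.1 1 - (z.1 2 * v.2 1 + z.2 1 * v.1 2) := by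
  have h : HasFDerivAt J1 _ z :=
    (hasFDerivAt_position_mul_momentum z 1 2).sub (hasFDerivAt_position_mul_momentum z 2 1)
  rw [h.fderiv]
  simp

lemma fderiv_J2_apply (z v : Phase) :
    fderiv ℝ J2 z v =
      z.1 2 * v.2 0 + z.2 0 * v.1 2 - (z.1 0 * v.2 2 + z.2 2 * v.1 0) := by
  have h : HasFDerivAt J2 _ z :=
    (hasFDerivAt_position_mul_momentum z 2 0).sub (hasFDerivAt_position_mul_momentum z 0 2)
  rw [h.fderiv]
  simp

lemma fderiv_J3_apply (z v : Phase) :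
    fderiv ℝ J3 z v =
      z.1 0 * v.2 1 + z.2 1 * v.1 0 - (z.1 1 * v.2 0 + z.2 0 * v.1 1) := by
  have h : HasFDerivAt J3 _ z :=
    (hasFDerivAt_position_mul_momentum z 0 1).sub (hasFDerivAt_position_mul_momentum z 1 0)
  rw [h.fderiv]
  simp

lemma pb_sphereF₁_position (z : Phase) (i : Fin 3) :
    pb sphereF₁ (fun w => w.1 i) z = 0 := by
  simp [pb, fderiv_sphereF₁_apply, fderiv_position_apply]

lemma pb_sphereF₁_Jv (z : Phase) (i : Fin 3) : pb sphereF₁ (Jv i) z = 0 := by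
  fin_cases i <;>
    simp [pb, Jv, Fin.sum_univ_three, fderiv_sphereF₁_apply, fderiv_J1_apply, fderiv_J2_apply,
      fderiv_J3_apply] <;>
    ring

/-- The sphere Dirac bracket agrees with the canonical bracket on functions that commute with
the constraint `sphereF₁`. -/
lemma diracS_eq_pb {f g : Phase → ℝ} {z : Phase} (hf : pb sphereF₁ f z = 0)
    (hg : pb sphereF₁ g z = 0) : diracS f g z = pb f g z := by
  simp [diracS, dirac, hf, hg]

/-- on T*S² the angular momenta and coordinates realize the
Lie–Poisson relations of e*(3) with respect to the sphere Dirac bracket,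
and the Casimirs take the values C₁ = 1, C₂ = 0. -/
theorem sphere_dirac_realizes_e3
    (z : Phase)
    (h1 : z.1 0 ^ 2 + z.1 1 ^ 2 + z.1 2 ^ 2 = 1)
    (h2 : z.1 0 * z.2 0 + z.1 1 * z.2 1 + z.1 2 * z.2 2 = 0) :
    (∀ i j : Fin 3, diracS (Jv i) (Jv j) z = ∑ k : Fin 3, eps i j k * Jv k z) ∧
    (∀ i j : Fin 3, diracS (fun w => w.1 i) (Jv j) z = ∑ k : Fin 3, eps i j k * z.1 k) ∧
    (∀ i j : Fin 3, diracS (fun w => w.1 i) (fun w => w.1 j) z = 0) ∧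
    z.1 0 ^ 2 + z.1 1 ^ 2 + z.1 2 ^ 2 = 1 ∧
    z.1 0 * J1 z + z.1 1 * J2 z + z.1 2 * J3 z = 0 := by
  refine ⟨fun i j => ?_, fun i j => ?_, fun i j => ?_, h1, ?_⟩
  · rw [diracS_eq_pb (pb_sphereF₁_Jv z i) (pb_sphereF₁_Jv z j)]
    fin_cases i <;> fin_cases j <;>
      simp [pb, Jv, eps, Fin.sum_univ_three, fderiv_J1_apply, fderiv_J2_apply,
        fderiv_J3_apply] <;>
      (try simp only [J1, J2, J3]) <;>
      ring
  · rw [diracS_eq_pb (pb_sphereF₁_position z i) (pb_sphereF₁_Jv z j)]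
    fin_cases i <;> fin_cases j <;>
      simp [pb, Jv, eps, Fin.sum_univ_three, fderiv_position_apply, fderiv_J1_apply,
        fderiv_J2_apply, fderiv_J3_apply]
  · rw [diracS_eq_pb (pb_sphereF₁_position z i) (pb_sphereF₁_position z j)]
    simp [pb, fderiv_position_apply]
  · simp only [J1, J2, J3]
    ring
end
end

section
/- Let a₁, a₂, a₃ be positive real numbers and consider the Dirac bracket {·,·}_D on ℝ³×ℝ³ associated with F₁ = x₁²/a₁ + x₂²/a₂ + x₃²/a₃ − 1 and F₂ = x₁p₁/a₁ + x₂p₂/a₂ + x₃p₃/a₃. Define y₁ = x₁/√a₁, y₂ = x₂/√a₂, y₃ = x₃/√a₃ and L₁ = (a₃p₃x₂ − a₂p₂x₃)/(√a₂√a₃), L₂ = (a₁p₁x₃ − a₃p₃x₁)/(√a₁√a₃), L₃ = (a₂p₂x₁ − a₁p₁x₂)/(√a₁√a₂). Then at every point of the constraint surface (where F₁ = 0 and F₂ = 0) the Lie–Poisson relations of e*(3) hold: {L_i, L_j}_D = ε_{ijk} L_k, {y_i, L_j}_D = ε_{ijk} y_k, and {y_i, y_j}_D = 0 for all i, j; moreover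 C₁ = y₁²+y₂²+y₃² = 1 and C₂ = y₁L₁+y₂L₂+y₃L₃ = 0 at these points. -/
noncomputable section

/-- Ellipsoid/hyperboloid constraint F₁ = x₁²/a₁ + x₂²/a₂ + x₃²/a₃ − 1. -/
noncomputable def ellF₁ (a₁ a₂ a₃ : ℝ) : Phase → ℝ := fun z =>
  z.1 0 ^ 2 / a₁ + z.1 1 ^ 2 / a₂ + z.1 2 ^ 2 / a₃ - 1

/-- Ellipsoid/hyperboloid constraint F₂ = x₁p₁/a₁ + x₂p₂/a₂ + x₃p₃/a₃. -/
noncomputable def ellF₂ (a₁ a₂ a₃ : ℝ) : Phase → ℝ := fun z =>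
  z.1 0 * z.2 0 / a₁ + z.1 1 * z.2 1 / a₂ + z.1 2 * z.2 2 / a₃

/-- Dirac bracket {·,·}_D on the ellipsoid/hyperboloid. -/
noncomputable def diracE (a₁ a₂ a₃ : ℝ) (f g : Phase → ℝ) (z : Phase) : ℝ :=
  dirac (ellF₁ a₁ a₂ a₃) (ellF₂ a₁ a₂ a₃) f g z

/-- y-variables: yᵢ = xᵢ/√aᵢ. -/
noncomputable def yv (a₁ a₂ a₃ : ℝ) : Fin 3 → Phase → ℝ :=
  ![fun z => z.1 0 / Real.sqrt a₁,
    fun z => z.1 1 / Real.sqrt a₂,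
    fun z => z.1 2 / Real.sqrt a₃]

/-- L-variables: L₁ = (a₃p₃x₂ − a₂p₂x₃)/(√a₂√a₃), etc. -/
noncomputable def Lv (a₁ a₂ a₃ : ℝ) : Fin 3 → Phase → ℝ :=
  ![fun z => (a₃ * z.2 2 * z.1 1 - a₂ * z.2 1 * z.1 2) / (Real.sqrt a₂ * Real.sqrt a₃),
    fun z => (a₁ * z.2 0 * z.1 2 - a₃ * z.2 2 * z.1 0) / (Real.sqrt a₁ * Real.sqrt a₃),
    fun z => (a₂ * z.2 1 * z.1 0 - a₁ * z.2 0 * z.1 1) / (Real.sqrt a₁ * Real.sqrt a₂)]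

theorem hasFDerivAt_fst_apply (i : Fin 3) (z : Phase) :
    HasFDerivAt (fun w : Phase => w.1 i)
      ((ContinuousLinearMap.proj i).comp (ContinuousLinearMap.fst ℝ (Fin 3 → ℝ) (Fin 3 → ℝ))) z :=
  ((ContinuousLinearMap.proj (R := ℝ) (φ := fun _ : Fin 3 => ℝ) i).comp
    (ContinuousLinearMap.fst ℝ (Fin 3 → ℝ) (Fin 3 → ℝ))).hasFDerivAt

theorem hasFDerivAt_snd_apply (i : Fin 3) (z : Phase) :
    HasFDerivAt (fun w : Phase => w.2 i)
      ((ContinuousLinearMap.proj i).comp (ContinuousLinearMap.snd ℝ (Fin 3 → ℝ) (Fin 3 → ℝ))) z :=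
  ((ContinuousLinearMap.proj (R := ℝ) (φ := fun _ : Fin 3 => ℝ) i).comp
    (ContinuousLinearMap.snd ℝ (Fin 3 → ℝ) (Fin 3 → ℝ))).hasFDerivAt

theorem fderiv_fst_apply_div (i : Fin 3) (d : ℝ) (z v : Phase) :
    fderiv ℝ (fun w : Phase => w.1 i / d) z v = v.1 i / d := by
  simp only [div_eq_mul_inv]
  rw [((hasFDerivAt_fst_apply i z).mul_const d⁻¹).fderiv]
  simp [mul_comm]

theorem fderiv_angular (i j : Fin 3) (b c d : ℝ) (z v : Phase) :
    fderiv ℝ (fun w : Phase => (b * w.2 j * w.1 i - c * w.2 i * w.1 j) / d) z v =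
      (b * (v.2 j * z.1 i + z.2 j * v.1 i) - c * (v.2 i * z.1 j + z.2 i * v.1 j)) / d := by
  simp only [div_eq_mul_inv]
  refine (DFunLike.congr_fun ((((hasFDerivAt_snd_apply j z).const_mul b).mul (hasFDerivAt_fst_apply i z)).sub
    (((hasFDerivAt_snd_apply i z).const_mul c).mul (hasFDerivAt_fst_apply j z))
    |>.mul_const d⁻¹).fderiv v).trans ?_
  simp
  ring

theorem fderiv_ellF₁ (a₁ a₂ a₃ : ℝ) (z v : Phase) :
    fderiv ℝ (ellF₁ a₁ a₂ a₃) z v =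
      2 * (z.1 0 * v.1 0 / a₁ + z.1 1 * v.1 1 / a₂ + z.1 2 * v.1 2 / a₃) := by
  unfold ellF₁
  simp only [div_eq_mul_inv]
  refine (DFunLike.congr_fun ((((((hasFDerivAt_fst_apply 0 z).pow 2).mul_const a₁⁻¹).add
    (((hasFDerivAt_fst_apply 1 z).pow 2).mul_const a₂⁻¹)).add
    (((hasFDerivAt_fst_apply 2 z).pow 2).mul_const a₃⁻¹)).sub_const 1).fderiv v).trans ?_
  simp
  ring

theorem pb_ellF₁_yv (a₁ a₂ a₃ : ℝ) (i : Fin 3) (z : Phase) :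
    pb (ellF₁ a₁ a₂ a₃) (yv a₁ a₂ a₃ i) z = 0 := by
  fin_cases i <;> simp [pb, yv, fderiv_ellF₁, fderiv_fst_apply_div]

theorem pb_yv_yv (a₁ a₂ a₃ : ℝ) (i j : Fin 3) (z : Phase) :
    pb (yv a₁ a₂ a₃ i) (yv a₁ a₂ a₃ j) z = 0 := by
  fin_cases i <;> fin_cases j <;> simp [pb, yv, fderiv_fst_apply_div]

theorem pb_ellF₁_Lv {a₁ a₂ a₃ : ℝ} (ha₁ : 0 < a₁) (ha₂ : 0 < a₂) (ha₃ : 0 < a₃)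
    (i : Fin 3) (z : Phase) :
    pb (ellF₁ a₁ a₂ a₃) (Lv a₁ a₂ a₃ i) z = 0 := by
  fin_cases i <;>
    simp [pb, Lv, Fin.sum_univ_three, fderiv_ellF₁, fderiv_angular, Pi.single_apply] <;>
    field_simp <;> ring

theorem pb_yv_Lv {a₁ a₂ a₃ : ℝ} (ha₁ : 0 < a₁) (ha₂ : 0 < a₂) (ha₃ : 0 < a₃)
    (i j : Fin 3) (z : Phase) :
    pb (yv a₁ a₂ a₃ i) (Lv a₁ a₂ a₃ j) z = ∑ k : Fin 3, eps i j k * yv a₁ a₂ a₃ k z := by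
  obtain ⟨s, hs, rfl⟩ : ∃ s : ℝ, 0 < s ∧ s ^ 2 = a₁ := ⟨√a₁, by positivity, Real.sq_sqrt ha₁.le⟩
  obtain ⟨t, ht, rfl⟩ : ∃ t : ℝ, 0 < t ∧ t ^ 2 = a₂ := ⟨√a₂, by positivity, Real.sq_sqrt ha₂.le⟩
  obtain ⟨u, hu, rfl⟩ : ∃ u : ℝ, 0 < u ∧ u ^ 2 = a₃ := ⟨√a₃, by positivity, Real.sq_sqrt ha₃.le⟩
  fin_cases i <;> fin_cases j <;>
    simp [pb, yv, Lv, eps, Fin.sum_univ_three, fderiv_fst_apply_div, fderiv_angular,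
      Pi.single_apply, Real.sqrt_sq, hs.le, ht.le, hu.le] <;>
    field_simp

theorem pb_Lv_Lv {a₁ a₂ a₃ : ℝ} (ha₁ : 0 < a₁) (ha₂ : 0 < a₂) (ha₃ : 0 < a₃)
    (i j : Fin 3) (z : Phase) :
    pb (Lv a₁ a₂ a₃ i) (Lv a₁ a₂ a₃ j) z = ∑ k : Fin 3, eps i j k * Lv a₁ a₂ a₃ k z := by
  obtain ⟨s, hs, rfl⟩ : ∃ s : ℝ, 0 < s ∧ s ^ 2 = a₁ := ⟨√a₁, by positivity, Real.sq_sqrt ha₁.le⟩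
  obtain ⟨t, ht, rfl⟩ : ∃ t : ℝ, 0 < t ∧ t ^ 2 = a₂ := ⟨√a₂, by positivity, Real.sq_sqrt ha₂.le⟩
  obtain ⟨u, hu, rfl⟩ : ∃ u : ℝ, 0 < u ∧ u ^ 2 = a₃ := ⟨√a₃, by positivity, Real.sq_sqrt ha₃.le⟩
  fin_cases i <;> fin_cases j <;>
    simp [pb, Lv, eps, Fin.sum_univ_three, fderiv_angular,
      Pi.single_apply, Real.sqrt_sq, hs.le, ht.le, hu.le] <;>
    field_simp <;> ring

theorem dirac_eq_pb_of_pb_eq_zero {F₁ F₂ f g : Phase → ℝ} {z : Phase}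
    (hf : pb F₁ f z = 0) (hg : pb F₁ g z = 0) : dirac F₁ F₂ f g z = pb f g z := by
  simp [dirac, hf, hg]

/-- on T*E² (aᵢ > 0) the variables (y, L) realize the Lie–Poisson
relations of e*(3) with respect to the Dirac bracket, with Casimir values
C₁ = 1 and C₂ = 0 on the constraint surface. -/
theorem ellipsoid_dirac_realizes_e3
    (a₁ a₂ a₃ : ℝ) (ha₁ : 0 < a₁) (ha₂ : 0 < a₂) (ha₃ : 0 < a₃)
    (z : Phase)
    (h1 : ellF₁ a₁ a₂ a₃ z = 0) (h2 : ellF₂ a₁ a₂ a₃ z = 0) :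
    (∀ i j : Fin 3, diracE a₁ a₂ a₃ (Lv a₁ a₂ a₃ i) (Lv a₁ a₂ a₃ j) z =
      ∑ k : Fin 3, eps i j k * Lv a₁ a₂ a₃ k z) ∧
    (∀ i j : Fin 3, diracE a₁ a₂ a₃ (yv a₁ a₂ a₃ i) (Lv a₁ a₂ a₃ j) z =
      ∑ k : Fin 3, eps i j k * yv a₁ a₂ a₃ k z) ∧
    (∀ i j : Fin 3, diracE a₁ a₂ a₃ (yv a₁ a₂ a₃ i) (yv a₁ a₂ a₃ j) z = 0) ∧
    (yv a₁ a₂ a₃ 0 z) ^ 2 + (yv a₁ a₂ a₃ 1 z) ^ 2 + (yv a₁ a₂ a₃ 2 z) ^ 2 = 1 ∧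
    yv a₁ a₂ a₃ 0 z * Lv a₁ a₂ a₃ 0 z + yv a₁ a₂ a₃ 1 z * Lv a₁ a₂ a₃ 1 z +
      yv a₁ a₂ a₃ 2 z * Lv a₁ a₂ a₃ 2 z = 0 := by
  refine ⟨fun i j => ?_, fun i j => ?_, fun i j => ?_, ?_, ?_⟩
  · exact (dirac_eq_pb_of_pb_eq_zero (pb_ellF₁_Lv ha₁ ha₂ ha₃ i z)
      (pb_ellF₁_Lv ha₁ ha₂ ha₃ j z)).trans (pb_Lv_Lv ha₁ ha₂ ha₃ i j z)
  · exact (dirac_eq_pb_of_pb_eq_zero (pb_ellF₁_yv a₁ a₂ a₃ i z)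
      (pb_ellF₁_Lv ha₁ ha₂ ha₃ j z)).trans (pb_yv_Lv ha₁ ha₂ ha₃ i j z)
  · exact (dirac_eq_pb_of_pb_eq_zero (pb_ellF₁_yv a₁ a₂ a₃ i z)
      (pb_ellF₁_yv a₁ a₂ a₃ j z)).trans (pb_yv_yv a₁ a₂ a₃ i j z)
  · simp only [ellF₁] at h1
    simp [yv, div_pow, Real.sq_sqrt, ha₁.le, ha₂.le, ha₃.le]
    linarith
  · simp [yv, Lv]
    field_simp
    ring
end
end

section
/- Let x₁, x₂, x₃, J₁, J₂, J₃, c be real numbers satisfying x₁²+x₂²+x₃² = 1 and x₁J₁+x₂J₂+x₃J₃ = 0, and let u, v be complex numbers. Define the 2×2 complex matrices A = [[u + 2J₃, c], [c, 0]] and B = [[u² − 2J₃u − J₁² − J₂², u(x₂ + i x₁) − x₃(J₂ + i J₁)], [u(x₂ − i x₁) − x₃(J₂ − i J₁), −x₃²]], and set T(u) = A·B. Then det(T(u) − v·Id) = v² − v(u³ − Hu − 2K) + c²u², where H = J₁² + J₂² + 4J₃² − 2c x₂ and K = J₃(J₁² + J₂²) + c x₃ J₂. -/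
noncomputable section

open Complex Matrix

/-- the spectral curve of the 2×2 Lax matrix T(u) = A·B of the
Goryachev–Chaplygin top: det(T(u) − v·Id) = v² − v(u³ − Hu − 2K) + c²u². -/
theorem goryachev_chaplygin_spectral_curve
    (x₁ x₂ x₃ J₁ J₂ J₃ c : ℝ)
    (h1 : x₁ ^ 2 + x₂ ^ 2 + x₃ ^ 2 = 1)
    (h2 : x₁ * J₁ + x₂ * J₂ + x₃ * J₃ = 0)
    (u v : ℂ)
    (A B : Matrix (Fin 2) (Fin 2) ℂ)
    (hA : A = !![u + 2 * (J₃ : ℂ), (c : ℂ); (c : ℂ), 0])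
    (hB : B = !![u ^ 2 - 2 * (J₃ : ℂ) * u - (J₁ : ℂ) ^ 2 - (J₂ : ℂ) ^ 2,
                 u * ((x₂ : ℂ) + Complex.I * (x₁ : ℂ)) -
                   (x₃ : ℂ) * ((J₂ : ℂ) + Complex.I * (J₁ : ℂ));
                 u * ((x₂ : ℂ) - Complex.I * (x₁ : ℂ)) -
                   (x₃ : ℂ) * ((J₂ : ℂ) - Complex.I * (J₁ : ℂ)),
                 -(x₃ : ℂ) ^ 2])
    (H K : ℝ)
    (hH : H = J₁ ^ 2 + J₂ ^ 2 + 4 * J₃ ^ 2 - 2 * c * x₂)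
    (hK : K = J₃ * (J₁ ^ 2 + J₂ ^ 2) + c * x₃ * J₂) :
    Matrix.det (A * B - v • (1 : Matrix (Fin 2) (Fin 2) ℂ)) =
      v ^ 2 - v * (u ^ 3 - (H : ℂ) * u - 2 * (K : ℂ)) + (c : ℂ) ^ 2 * u ^ 2 := by
  have h1' : (x₁ : ℂ) ^ 2 + (x₂ : ℂ) ^ 2 + (x₃ : ℂ) ^ 2 = 1 := by exact_mod_cast h1
  have h2' : (x₁ : ℂ) * J₁ + (x₂ : ℂ) * J₂ + (x₃ : ℂ) * J₃ = 0 := by exact_mod_cast h2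
  subst hA hB hH hK
  simp only [Matrix.mul_fin_two, Matrix.one_fin_two, Matrix.smul_of, Matrix.smul_cons,
    Matrix.smul_empty, Matrix.det_fin_two, Matrix.sub_apply, Matrix.of_apply,
    Matrix.cons_val_zero, Matrix.cons_val_one, Matrix.cons_val', Matrix.cons_val_fin_one,
    smul_eq_mul]
  push_cast
  linear_combination (c : ℂ) ^ 2 * u ^ 2 * h1' - 2 * (c : ℂ) ^ 2 * u * (x₃ : ℂ) * h2' -
    (c : ℂ) ^ 2 * (u * (x₁ : ℂ) - (x₃ : ℂ) * (J₁ : ℂ)) ^ 2 * Complex.I_sq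
end
end

section
/- Let a be a real number. With J₁ = x₂p₃ − x₃p₂, J₂ = x₃p₁ − x₁p₃, J₃ = x₁p₂ − x₂p₁, define the Gaffet integrals H = J₁² + J₂² + J₃² + a²/(x₁x₂x₃)^{2/3} and K = J₁J₂J₃ − a²(J₁/x₁ + J₂/x₂ + J₃/x₃)·(x₁x₂x₃)^{1/3}. Then {H, K}_S = 0 at every point of the constraint surface T*S² (where x₁²+x₂²+x₃² = 1 and x₁p₁+x₂p₂+x₃p₃ = 0) with x₁ > 0, x₂ > 0, x₃ > 0. -/
noncomputable section

/-- The differential of the position coordinate `x_i` on phase space. -/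
def dPos (i : Fin 3) : Phase →L[ℝ] ℝ :=
  (ContinuousLinearMap.proj i).comp (ContinuousLinearMap.fst ℝ (Fin 3 → ℝ) (Fin 3 → ℝ))

/-- The differential of the momentum coordinate `p_i` on phase space. -/
def dMom (i : Fin 3) : Phase →L[ℝ] ℝ :=
  (ContinuousLinearMap.proj i).comp (ContinuousLinearMap.snd ℝ (Fin 3 → ℝ) (Fin 3 → ℝ))

@[simp] lemma dPos_apply (i : Fin 3) (v : Phase) : dPos i v = v.1 i := rfl

@[simp] lemma dMom_apply (i : Fin 3) (v : Phase) : dMom i v = v.2 i := rfl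

lemma hasFDerivAt_pos (i : Fin 3) (z : Phase) :
    HasFDerivAt (fun w : Phase => w.1 i) (dPos i) z :=
  (dPos i).hasFDerivAt

lemma hasFDerivAt_mom (i : Fin 3) (z : Phase) :
    HasFDerivAt (fun w : Phase => w.2 i) (dMom i) z :=
  (dMom i).hasFDerivAt

/-- The bracket of two functions with known differentials. -/
lemma pb_eq_of_hasFDerivAt {f g : Phase → ℝ} {f' g' : Phase →L[ℝ] ℝ} {z : Phase}
    (hf : HasFDerivAt f f' z) (hg : HasFDerivAt g g' z) :
    pb f g z = ∑ i : Fin 3,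
      (f' (Pi.single i 1, 0) * g' (0, Pi.single i 1) -
        f' (0, Pi.single i 1) * g' (Pi.single i 1, 0)) := by
  simp only [pb, hf.fderiv, hg.fderiv]

lemma HasFDerivAt.div_pos_coord {f : Phase → ℝ} {f' : Phase →L[ℝ] ℝ} {z : Phase}
    (hf : HasFDerivAt f f' z) {i : Fin 3} (hi : z.1 i ≠ 0) :
    HasFDerivAt (fun w : Phase => f w / w.1 i)
      ((z.1 i)⁻¹ • f' - (f z / z.1 i ^ 2) • dPos i) z := by
  have h := hf.mul ((hasDerivAt_inv hi).comp_hasFDerivAt z (hasFDerivAt_pos i z))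
  refine (h.congr_fderiv ?_).congr_of_eventuallyEq (.of_forall fun w => div_eq_mul_inv _ _)
  refine ContinuousLinearMap.ext fun v => ?_
  simp
  ring

lemma hasFDerivAt_sphereF₁ (z : Phase) :
    HasFDerivAt sphereF₁
      ((2 * z.1 0) • dPos 0 + (2 * z.1 1) • dPos 1 + (2 * z.1 2) • dPos 2) z := by
  have h := ((((hasFDerivAt_pos 0 z).pow 2).add ((hasFDerivAt_pos 1 z).pow 2)).add
    ((hasFDerivAt_pos 2 z).pow 2)).sub_const 1
  refine h.congr_fderiv ?_
  ext v <;> simp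

lemma hasFDerivAt_J1 (z : Phase) :
    HasFDerivAt J1
      (z.1 1 • dMom 2 + z.2 2 • dPos 1 - (z.1 2 • dMom 1 + z.2 1 • dPos 2)) z :=
  ((hasFDerivAt_pos 1 z).mul (hasFDerivAt_mom 2 z)).sub
    ((hasFDerivAt_pos 2 z).mul (hasFDerivAt_mom 1 z))

lemma hasFDerivAt_J2 (z : Phase) :
    HasFDerivAt J2
      (z.1 2 • dMom 0 + z.2 0 • dPos 2 - (z.1 0 • dMom 2 + z.2 2 • dPos 0)) z :=
  ((hasFDerivAt_pos 2 z).mul (hasFDerivAt_mom 0 z)).sub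
    ((hasFDerivAt_pos 0 z).mul (hasFDerivAt_mom 2 z))

lemma hasFDerivAt_J3 (z : Phase) :
    HasFDerivAt J3
      (z.1 0 • dMom 1 + z.2 1 • dPos 0 - (z.1 1 • dMom 0 + z.2 0 • dPos 1)) z :=
  ((hasFDerivAt_pos 0 z).mul (hasFDerivAt_mom 1 z)).sub
    ((hasFDerivAt_pos 1 z).mul (hasFDerivAt_mom 0 z))

/-- The logarithmic differential `∑ dx_i / x_i` of `x₁x₂x₃`. -/
def dLogProd (z : Phase) : Phase →L[ℝ] ℝ :=
  (z.1 0)⁻¹ • dPos 0 + (z.1 1)⁻¹ • dPos 1 + (z.1 2)⁻¹ • dPos 2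

lemma hasFDerivAt_prod_rpow {z : Phase} (hx1 : 0 < z.1 0) (hx2 : 0 < z.1 1) (hx3 : 0 < z.1 2)
    (r : ℝ) :
    HasFDerivAt (fun w : Phase => (w.1 0 * w.1 1 * w.1 2) ^ r)
      ((r * (z.1 0 * z.1 1 * z.1 2) ^ r) • dLogProd z) z := by
  have hm : 0 < z.1 0 * z.1 1 * z.1 2 := by positivity
  have h := (((hasFDerivAt_pos 0 z).mul (hasFDerivAt_pos 1 z)).mul
    (hasFDerivAt_pos 2 z)).rpow_const (p := r) (Or.inl hm.ne')
  refine h.congr_fderiv ?_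
  refine ContinuousLinearMap.ext fun v => ?_
  simp [dLogProd, Real.rpow_sub_one hm.ne']
  field_simp
  ring

lemma hasFDerivAt_gaffetH (a : ℝ) {z : Phase}
    (hx1 : 0 < z.1 0) (hx2 : 0 < z.1 1) (hx3 : 0 < z.1 2) :
    HasFDerivAt
      (fun w : Phase => J1 w ^ 2 + J2 w ^ 2 + J3 w ^ 2 +
        a ^ 2 / (w.1 0 * w.1 1 * w.1 2) ^ ((2 : ℝ) / 3))
      ((2 * J1 z) • (z.1 1 • dMom 2 + z.2 2 • dPos 1 - (z.1 2 • dMom 1 + z.2 1 • dPos 2)) +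
        (2 * J2 z) • (z.1 2 • dMom 0 + z.2 0 • dPos 2 - (z.1 0 • dMom 2 + z.2 2 • dPos 0)) +
        (2 * J3 z) • (z.1 0 • dMom 1 + z.2 1 • dPos 0 - (z.1 1 • dMom 0 + z.2 0 • dPos 1)) -
        (2 / 3 * a ^ 2 * (z.1 0 * z.1 1 * z.1 2) ^ ((1 : ℝ) / 3) / (z.1 0 * z.1 1 * z.1 2)) •
          dLogProd z) z := by
  have hm : 0 < z.1 0 * z.1 1 * z.1 2 := by positivity
  have hV : HasFDerivAt (fun w : Phase => a ^ 2 / (w.1 0 * w.1 1 * w.1 2) ^ ((2 : ℝ) / 3))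
      (a ^ 2 • ((-(2 / 3) * (z.1 0 * z.1 1 * z.1 2) ^ (-(2 / 3) : ℝ)) • dLogProd z)) z := by
    refine ((hasFDerivAt_prod_rpow hx1 hx2 hx3 (-(2 / 3))).const_mul (a ^ 2)).congr_of_eventuallyEq
      ?_
    have hc : Continuous fun w : Phase => w.1 0 * w.1 1 * w.1 2 := by fun_prop
    filter_upwards [hc.continuousAt.eventually (lt_mem_nhds hm)] with w hw
    rw [Real.rpow_neg hw.le, div_eq_mul_inv]
  have hs : (z.1 0 * z.1 1 * z.1 2) ^ (-(2 / 3) : ℝ) =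
      (z.1 0 * z.1 1 * z.1 2) ^ ((1 : ℝ) / 3) / (z.1 0 * z.1 1 * z.1 2) := by
    rw [← Real.rpow_sub_one hm.ne']
    norm_num
  have h := ((((hasFDerivAt_J1 z).pow 2).add ((hasFDerivAt_J2 z).pow 2)).add
    ((hasFDerivAt_J3 z).pow 2)).add hV
  refine h.congr_fderiv ?_
  rw [hs]
  ext v <;> simp <;> ring

lemma hasFDerivAt_gaffetK (a : ℝ) {z : Phase}
    (hx1 : 0 < z.1 0) (hx2 : 0 < z.1 1) (hx3 : 0 < z.1 2) :
    HasFDerivAt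
      (fun w : Phase => J1 w * J2 w * J3 w -
        a ^ 2 * (J1 w / w.1 0 + J2 w / w.1 1 + J3 w / w.1 2) *
          (w.1 0 * w.1 1 * w.1 2) ^ ((1 : ℝ) / 3))
      ((J2 z * J3 z - a ^ 2 * (z.1 0 * z.1 1 * z.1 2) ^ ((1 : ℝ) / 3) / z.1 0) •
          (z.1 1 • dMom 2 + z.2 2 • dPos 1 - (z.1 2 • dMom 1 + z.2 1 • dPos 2)) +
        (J1 z * J3 z - a ^ 2 * (z.1 0 * z.1 1 * z.1 2) ^ ((1 : ℝ) / 3) / z.1 1) •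
          (z.1 2 • dMom 0 + z.2 0 • dPos 2 - (z.1 0 • dMom 2 + z.2 2 • dPos 0)) +
        (J1 z * J2 z - a ^ 2 * (z.1 0 * z.1 1 * z.1 2) ^ ((1 : ℝ) / 3) / z.1 2) •
          (z.1 0 • dMom 1 + z.2 1 • dPos 0 - (z.1 1 • dMom 0 + z.2 0 • dPos 1)) -
        (a ^ 2 * (z.1 0 * z.1 1 * z.1 2) ^ ((1 : ℝ) / 3)) •
          ((1 / 3 * (J1 z / z.1 0 + J2 z / z.1 1 + J3 z / z.1 2)) • dLogProd z -
            ((J1 z / z.1 0 ^ 2) • dPos 0 + (J2 z / z.1 1 ^ 2) • dPos 1 +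
              (J3 z / z.1 2 ^ 2) • dPos 2))) z := by
  have h := (((hasFDerivAt_J1 z).mul (hasFDerivAt_J2 z)).mul (hasFDerivAt_J3 z)).sub
    ((((((hasFDerivAt_J1 z).div_pos_coord hx1.ne').add
      ((hasFDerivAt_J2 z).div_pos_coord hx2.ne')).add
      ((hasFDerivAt_J3 z).div_pos_coord hx3.ne')).const_mul (a ^ 2)).mul
      (hasFDerivAt_prod_rpow hx1 hx2 hx3 (1 / 3)))
  refine h.congr_fderiv ?_
  refine ContinuousLinearMap.ext fun v => ?_
  simp [dLogProd]
  field_simp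
  ring

/-- the Gaffet integrals H = J₁² + J₂² + J₃² + a²/(x₁x₂x₃)^{2/3}
and K = J₁J₂J₃ − a²(J₁/x₁ + J₂/x₂ + J₃/x₃)(x₁x₂x₃)^{1/3} are in involution with
respect to the sphere Dirac bracket on T*S² in the positive octant. -/
theorem gaffet_sphere_involution
    (a : ℝ) (z : Phase)
    (h1 : z.1 0 ^ 2 + z.1 1 ^ 2 + z.1 2 ^ 2 = 1)
    (h2 : z.1 0 * z.2 0 + z.1 1 * z.2 1 + z.1 2 * z.2 2 = 0)
    (hx1 : 0 < z.1 0) (hx2 : 0 < z.1 1) (hx3 : 0 < z.1 2) :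
    diracS
      (fun w => J1 w ^ 2 + J2 w ^ 2 + J3 w ^ 2 +
        a ^ 2 / (w.1 0 * w.1 1 * w.1 2) ^ ((2 : ℝ) / 3))
      (fun w => J1 w * J2 w * J3 w -
        a ^ 2 * (J1 w / w.1 0 + J2 w / w.1 1 + J3 w / w.1 2) *
          (w.1 0 * w.1 1 * w.1 2) ^ ((1 : ℝ) / 3)) z = 0 := by
  have hH := hasFDerivAt_gaffetH a hx1 hx2 hx3
  have hK := hasFDerivAt_gaffetK a hx1 hx2 hx3
  have hF := hasFDerivAt_sphereF₁ z
  have hFH := pb_eq_of_hasFDerivAt hF hH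
  have hFK := pb_eq_of_hasFDerivAt hF hK
  have hHK := pb_eq_of_hasFDerivAt hH hK
  simp only [Fin.sum_univ_three, dLogProd, add_apply,
    sub_apply, smul_apply, smul_eq_mul, dPos_apply,
    dMom_apply, Pi.zero_apply, Pi.single_apply, Fin.reduceEq, if_true, if_false] at hFH hFK hHK
  -- the Gaffet integrals are functions of `x` and the angular momentum, so `{F₁, ·}` kills them
  replace hFH := hFH.trans (show _ = (0 : ℝ) by ring)
  replace hFK := hFK.trans (show _ = (0 : ℝ) by ring)
  rw [diracS, dirac, hFH, hFK, hHK, zero_mul, zero_mul, sub_zero, zero_div, sub_zero]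
  generalize (z.1 0 * z.1 1 * z.1 2) ^ ((1 : ℝ) / 3) = s
  have h0 := hx1.ne'
  have h0' := hx2.ne'
  have h0'' := hx3.ne'
  linear_combination (norm := skip)
    (2 / 3 * a ^ 2 * s / (z.1 0 * z.1 1 * z.1 2) *
      (J2 z * J3 z * (z.1 1 / z.1 2 - z.1 2 / z.1 1) +
        J3 z * J1 z * (z.1 2 / z.1 0 - z.1 0 / z.1 2) +
        J1 z * J2 z * (z.1 0 / z.1 1 - z.1 1 / z.1 0))) * h1
  simp only [J1, J2, J3]
  field_simp
  ring
end
end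

section
/- Let a be a real number. On the phase space ℝ²×ℝ² with coordinates (x₁,x₂,p₁,p₂) and the canonical Poisson bracket {f,g} = Σ_{i=1}^{2}(∂f/∂x_i · ∂g/∂p_i − ∂f/∂p_i · ∂g/∂x_i), define the Fokas–Lagerström integrals H = p₁² + p₂² + a²/(x₁²x₂²)^{1/3} and K = p₁p₂(p₁x₂ − p₂x₁) − a²(p₁x₁ − p₂x₂)/(x₁²x₂²)^{1/3}. Then {H, K} = 0 at every point with x₁ > 0 and x₂ > 0. -/
noncomputable section

/-- Phase space ℝ² × ℝ² with coordinates (x, p). -/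
abbrev Phase2 : Type := (Fin 2 → ℝ) × (Fin 2 → ℝ)

/-- Canonical Poisson bracket on ℝ² × ℝ². -/
noncomputable def pb2 (f g : Phase2 → ℝ) (z : Phase2) : ℝ :=
  ∑ i : Fin 2,
    (fderiv ℝ f z (Pi.single i 1, 0) * fderiv ℝ g z (0, Pi.single i 1) -
     fderiv ℝ f z (0, Pi.single i 1) * fderiv ℝ g z (Pi.single i 1, 0))

open ContinuousLinearMap in
/-- The differential of a position coordinate. -/
theorem hasFDerivAt_position_s15 (z : Phase2) (i : Fin 2) :
    HasFDerivAt (fun w : Phase2 => w.1 i)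
      ((proj (R := ℝ) (φ := fun _ : Fin 2 => ℝ) i).comp (fst ℝ _ (Fin 2 → ℝ))) z :=
  ((proj (R := ℝ) (φ := fun _ : Fin 2 => ℝ) i).comp
    (fst ℝ (Fin 2 → ℝ) (Fin 2 → ℝ))).hasFDerivAt

open ContinuousLinearMap in
/-- The differential of a momentum coordinate. -/
theorem hasFDerivAt_momentum_s15 (z : Phase2) (i : Fin 2) :
    HasFDerivAt (fun w : Phase2 => w.2 i)
      ((proj (R := ℝ) (φ := fun _ : Fin 2 => ℝ) i).comp (snd ℝ (Fin 2 → ℝ) _)) z :=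
  ((proj (R := ℝ) (φ := fun _ : Fin 2 => ℝ) i).comp
    (snd ℝ (Fin 2 → ℝ) (Fin 2 → ℝ))).hasFDerivAt

open ContinuousLinearMap in
/-- The differential of the cube root of `x₁²x₂²` on the open quadrant. -/
theorem hasFDerivAt_cbrt_sq_mul_sq (z : Phase2) (hx1 : 0 < z.1 0) (hx2 : 0 < z.1 1) :
    HasFDerivAt (fun w : Phase2 => (w.1 0 ^ 2 * w.1 1 ^ 2) ^ ((1 : ℝ) / 3))
      ((2 / 3 * (z.1 0 ^ 2 * z.1 1 ^ 2) ^ ((1 : ℝ) / 3)) •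
        ((z.1 0)⁻¹ • (proj (R := ℝ) (φ := fun _ : Fin 2 => ℝ) 0).comp (fst ℝ _ (Fin 2 → ℝ)) +
          (z.1 1)⁻¹ • (proj (R := ℝ) (φ := fun _ : Fin 2 => ℝ) 1).comp (fst ℝ _ (Fin 2 → ℝ)))) z := by
  have hx := hasFDerivAt_position_s15 z
  have hpos : 0 < z.1 0 ^ 2 * z.1 1 ^ 2 := by positivity
  refine ((((hx 0).pow 2).mul ((hx 1).pow 2)).rpow_const
    (p := 1 / 3) (Or.inl hpos.ne')).congr_fderiv ?_
  ext v <;> simp [Real.rpow_sub_one hpos.ne']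
  field_simp
  ring

/-- the Fokas–Lagerström integrals
H = p₁² + p₂² + a²/(x₁²x₂²)^{1/3} and
K = p₁p₂(p₁x₂ − p₂x₁) − a²(p₁x₁ − p₂x₂)/(x₁²x₂²)^{1/3}
are in involution with respect to the canonical Poisson bracket at every point
with x₁ > 0 and x₂ > 0. -/
theorem fokas_lagerstrom_involution
    (a : ℝ) (z : Phase2) (hx1 : 0 < z.1 0) (hx2 : 0 < z.1 1) :
    pb2
      (fun w => w.2 0 ^ 2 + w.2 1 ^ 2 + a ^ 2 / (w.1 0 ^ 2 * w.1 1 ^ 2) ^ ((1 : ℝ) / 3))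
      (fun w => w.2 0 * w.2 1 * (w.2 0 * w.1 1 - w.2 1 * w.1 0) -
        a ^ 2 * (w.2 0 * w.1 0 - w.2 1 * w.1 1) /
          (w.1 0 ^ 2 * w.1 1 ^ 2) ^ ((1 : ℝ) / 3)) z = 0 := by
  have hr := hasFDerivAt_cbrt_sq_mul_sq z hx1 hx2
  have hr0 : (z.1 0 ^ 2 * z.1 1 ^ 2) ^ ((1 : ℝ) / 3) ≠ 0 := by positivity
  have hx := hasFDerivAt_position_s15 z
  have hp := hasFDerivAt_momentum_s15 z
  have hri := (hasDerivAt_inv hr0).comp_hasFDerivAt z hr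
  have hH := (((hp 0).pow 2).add ((hp 1).pow 2)).add (hri.const_mul (a ^ 2))
  have hK := (((hp 0).mul (hp 1)).mul (((hp 0).mul (hx 1)).sub ((hp 1).mul (hx 0)))).sub
    (((((hp 0).mul (hx 0)).sub ((hp 1).mul (hx 1))).const_mul (a ^ 2)).mul hri)
  simp only [pb2, div_eq_mul_inv _ (_ ^ ((1 : ℝ) / 3))]
  erw [hH.fderiv, hK.fderiv]
  simp only [Function.comp_apply]
  generalize (z.1 0 ^ 2 * z.1 1 ^ 2) ^ ((1 : ℝ) / 3) = r at hr0 ⊢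
  simp [Fin.sum_univ_two]
  field_simp
  ring
end
end

section
/- (Maupertuis principle.) Let n ≥ 1 and consider ℝⁿ×ℝⁿ with coordinates (q,p) and canonical Poisson bracket {f,g} = Σ_{i=1}^{n}(∂f/∂q_i · ∂g/∂p_i − ∂f/∂p_i · ∂g/∂q_i). Let T be a smooth function with T(q, λp) = λ²T(q,p) for all λ > 0, let V be a smooth function of q only, let m ∈ ℕ, and let K = Σ_{j=0}^{⌊m/2⌋} K_{m−2j} be a finite sum of smooth functions where each K_{m−2j} satisfies K_{m−2j}(q, λp) = λ^{m−2j}·K_{m−2j}(q,p) for all λ > 0 (so all terms of K are homogeneous in p of the same parity). Let h ∈ ℝ. If {T + V, K} = 0 identically, then at every point (q,p) with V(q) ≠ h one has {T̃, K̃} = 0, where T̃ = T/(h − V) and K̃ = Σ_{j=0}^{⌊m/2⌋} T̃^{j}·K_{m−2j}. -/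
noncomputable section

/-- Canonical Poisson bracket on ℝⁿ × ℝⁿ. -/
noncomputable def pbN (n : ℕ) (f g : ((Fin n → ℝ) × (Fin n → ℝ)) → ℝ)
    (z : (Fin n → ℝ) × (Fin n → ℝ)) : ℝ :=
  ∑ i : Fin n,
    (fderiv ℝ f z (Pi.single i 1, 0) * fderiv ℝ g z (0, Pi.single i 1) -
     fderiv ℝ f z (0, Pi.single i 1) * fderiv ℝ g z (Pi.single i 1, 0))

/-- The canonical Poisson bivector on ℝⁿ × ℝⁿ, as a bilinear form on covectors. -/
def poissonForm (n : ℕ) :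
    (((Fin n → ℝ) × (Fin n → ℝ)) →L[ℝ] ℝ) →ₗ[ℝ]
      (((Fin n → ℝ) × (Fin n → ℝ)) →L[ℝ] ℝ) →ₗ[ℝ] ℝ :=
  LinearMap.mk₂ ℝ
    (fun α β => ∑ i : Fin n,
      (α (Pi.single i 1, 0) * β (0, Pi.single i 1) - α (0, Pi.single i 1) * β (Pi.single i 1, 0)))
    (fun α α' β => by
      simp only [add_apply, ← Finset.sum_add_distrib]
      exact Finset.sum_congr rfl fun i _ => by ring)
    (fun c α β => by
      simp only [smul_apply, smul_eq_mul, Finset.mul_sum]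
      exact Finset.sum_congr rfl fun i _ => by ring)
    (fun α β β' => by
      simp only [add_apply, ← Finset.sum_add_distrib]
      exact Finset.sum_congr rfl fun i _ => by ring)
    (fun c α β => by
      simp only [smul_apply, smul_eq_mul, Finset.mul_sum]
      exact Finset.sum_congr rfl fun i _ => by ring)

theorem pbN_eq_poissonForm {n : ℕ} (f g : ((Fin n → ℝ) × (Fin n → ℝ)) → ℝ)
    (z : (Fin n → ℝ) × (Fin n → ℝ)) :
    pbN n f g z = poissonForm n (fderiv ℝ f z) (fderiv ℝ g z) := rfl

theorem poissonForm_self {n : ℕ} (α : ((Fin n → ℝ) × (Fin n → ℝ)) →L[ℝ] ℝ) :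
    poissonForm n α α = 0 := by
  simp [poissonForm, mul_comm]

theorem fderiv_apply_of_scaling {E F : Type*} [NormedAddCommGroup E] [NormedSpace ℝ E]
    [NormedAddCommGroup F] [NormedSpace ℝ F] {f : E × F → ℝ} (hf : Differentiable ℝ f) {t c : ℝ}
    (hfc : ∀ q p, f (q, t • p) = c * f (q, p)) (q u : E) (p v : F) :
    fderiv ℝ f (q, t • p) (u, t • v) = c * fderiv ℝ f (q, p) (u, v) := by
  let S : E × F →L[ℝ] E × F :=
    (ContinuousLinearMap.id ℝ E).prodMap (t • ContinuousLinearMap.id ℝ F)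
  have h₁ : HasFDerivAt (fun w => f (S w)) ((fderiv ℝ f (S (q, p))).comp S) (q, p) :=
    (hf (S (q, p))).hasFDerivAt.comp (q, p) S.hasFDerivAt
  have h₂ : HasFDerivAt (fun w => f (S w)) (c • fderiv ℝ f (q, p)) (q, p) := by
    have h₃ := (hf (q, p)).hasFDerivAt.const_mul c
    exact h₃.congr_of_eventuallyEq (.of_forall fun w => hfc w.1 w.2)
  exact DFunLike.congr_fun (h₁.unique h₂) (u, v)

theorem mul_pbN_of_scaling {n : ℕ} {f g : ((Fin n → ℝ) × (Fin n → ℝ)) → ℝ}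
    (hf : Differentiable ℝ f) (hg : Differentiable ℝ g) {t a b : ℝ}
    (hfa : ∀ q p, f (q, t • p) = a * f (q, p)) (hgb : ∀ q p, g (q, t • p) = b * g (q, p))
    (q p : Fin n → ℝ) :
    t * pbN n f g (q, t • p) = a * b * pbN n f g (q, p) := by
  simp only [pbN, Finset.mul_sum]
  refine Finset.sum_congr rfl fun i _ => ?_
  have fq := fderiv_apply_of_scaling hf hfa q (Pi.single i 1) p 0
  have fp := fderiv_apply_of_scaling hf hfa q 0 p (Pi.single i 1)
  have gq := fderiv_apply_of_scaling hg hgb q (Pi.single i 1) p 0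
  have gp := fderiv_apply_of_scaling hg hgb q 0 p (Pi.single i 1)
  have smul_vert (v : Fin n → ℝ) : ((0 : Fin n → ℝ), t • v) = t • ((0 : Fin n → ℝ), v) := by simp
  rw [smul_zero] at fq gq
  rw [smul_vert, map_smul, smul_eq_mul] at fp gp
  rw [fq, gq]
  linear_combination a * fderiv ℝ f (q, p) (Pi.single i 1, 0) * gp -
    b * fderiv ℝ g (q, p) (Pi.single i 1, 0) * fp

theorem pbN_add_sum {n : ℕ} {ι : Type*} {f f' : ((Fin n → ℝ) × (Fin n → ℝ)) → ℝ}
    {g : ι → ((Fin n → ℝ) × (Fin n → ℝ)) → ℝ} {s : Finset ι} (hf : Differentiable ℝ f)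
    (hf' : Differentiable ℝ f') (hg : ∀ j ∈ s, Differentiable ℝ (g j))
    (z : (Fin n → ℝ) × (Fin n → ℝ)) :
    pbN n (fun w => f w + f' w) (fun w => ∑ j ∈ s, g j w) z =
      ∑ j ∈ s, (pbN n f (g j) z + pbN n f' (g j) z) := by
  simp only [pbN_eq_poissonForm, fderiv_fun_add (hf z) (hf' z),
    fderiv_fun_sum fun j hj => hg j hj z, map_sum, map_add, LinearMap.add_apply]

/-- A function commutes with its own powers, so they come out of the bracket. -/
theorem pbN_sum_pow_mul {n : ℕ} {f : ((Fin n → ℝ) × (Fin n → ℝ)) → ℝ}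
    {g : ℕ → ((Fin n → ℝ) × (Fin n → ℝ)) → ℝ} {s : Finset ℕ} {z : (Fin n → ℝ) × (Fin n → ℝ)}
    (hf : DifferentiableAt ℝ f z) (hg : ∀ j ∈ s, DifferentiableAt ℝ (g j) z) :
    pbN n f (fun w => ∑ j ∈ s, f w ^ j * g j w) z = ∑ j ∈ s, f z ^ j * pbN n f (g j) z := by
  simp only [pbN_eq_poissonForm]
  rw [fderiv_fun_sum fun j hj => (hf.fun_pow j).fun_mul (hg j hj), map_sum]
  refine Finset.sum_congr rfl fun j hj => ?_
  rw [fderiv_fun_mul (hf.fun_pow j) (hg j hj), fderiv_fun_pow j hf]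
  simp [poissonForm_self]

theorem pbN_div_sub {n : ℕ} {f v g : ((Fin n → ℝ) × (Fin n → ℝ)) → ℝ} {h : ℝ}
    {z : (Fin n → ℝ) × (Fin n → ℝ)} (hf : DifferentiableAt ℝ f z) (hv : DifferentiableAt ℝ v z)
    (hz : v z ≠ h) :
    pbN n (fun w => f w / (h - v w)) g z =
      (h - v z)⁻¹ * (pbN n f g z + f z / (h - v z) * pbN n v g z) := by
  have hd : h - v z ≠ 0 := sub_ne_zero.mpr hz.symm
  have key : HasFDerivAt (fun w => f w / (h - v w))
      ((h - v z)⁻¹ • (fderiv ℝ f z + (f z / (h - v z)) • fderiv ℝ v z)) z := by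
    simp only [div_eq_mul_inv]
    refine (hf.hasFDerivAt.fun_mul
      ((hasDerivAt_inv hd).comp_hasFDerivAt z (hv.hasFDerivAt.const_sub h))).congr_fderiv ?_
    refine ContinuousLinearMap.ext fun x => ?_
    simp only [add_apply, smul_apply, neg_apply, smul_eq_mul, Function.comp_apply]
    field_simp
    ring
  simp only [pbN_eq_poissonForm, key.fderiv, map_smul, map_add,
    LinearMap.smul_apply, LinearMap.add_apply, smul_eq_mul]

/-- A polynomial expression vanishing at all positive reals vanishes everywhere. -/
theorem sum_pow_mul_eq_zero_of_pos {N : ℕ} {a b : ℕ → ℝ}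
    (hpos : ∀ s : ℝ, 0 < s → ∑ j ∈ Finset.range N, s ^ j * (a j + s * b j) = 0) (x : ℝ) :
    ∑ j ∈ Finset.range N, x ^ j * (a j + x * b j) = 0 := by
  let P : Polynomial ℝ := ∑ j ∈ Finset.range N,
    Polynomial.X ^ j * (Polynomial.C (a j) + Polynomial.X * Polynomial.C (b j))
  have heval (y : ℝ) : P.eval y = ∑ j ∈ Finset.range N, y ^ j * (a j + y * b j) := by
    simp [P, Polynomial.eval_finsetSum, mul_comm (b _)]
  have hP : P = 0 := Polynomial.eq_zero_of_infinite_isRoot P <|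
    (Set.Ioi_infinite (0 : ℝ)).mono fun s hs => (heval s).trans (hpos s hs)
  rw [← heval, hP, Polynomial.eval_zero]

/-- Maupertuis principle: if the natural Hamiltonian H = T + V
commutes with K = Σ_{j=0}^{⌊m/2⌋} K_{m−2j}, a sum of momentum-homogeneous parts
of degrees m − 2j, then the geodesic Hamiltonian T̃ = T/(h − V) commutes with
K̃ = Σ_j T̃ʲ K_{m−2j} wherever V ≠ h. -/
theorem maupertuis_principle
    (n : ℕ) (hn : 1 ≤ n)
    (T : ((Fin n → ℝ) × (Fin n → ℝ)) → ℝ) (hT : ContDiff ℝ (⊤ : ℕ∞) T)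
    (hThom : ∀ (q p : Fin n → ℝ), ∀ t : ℝ, 0 < t → T (q, t • p) = t ^ 2 * T (q, p))
    (V : (Fin n → ℝ) → ℝ) (hV : ContDiff ℝ (⊤ : ℕ∞) V)
    (m : ℕ)
    (Kpart : ℕ → ((Fin n → ℝ) × (Fin n → ℝ)) → ℝ)
    (hKsmooth : ∀ j ≤ m / 2, ContDiff ℝ (⊤ : ℕ∞) (Kpart j))
    (hKhom : ∀ j ≤ m / 2, ∀ (q p : Fin n → ℝ), ∀ t : ℝ, 0 < t →
      Kpart j (q, t • p) = t ^ (m - 2 * j) * Kpart j (q, p))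
    (h : ℝ)
    (hcomm : ∀ z, pbN n (fun w => T w + V w.1)
      (fun w => ∑ j ∈ Finset.range (m / 2 + 1), Kpart j w) z = 0) :
    ∀ z : (Fin n → ℝ) × (Fin n → ℝ), V z.1 ≠ h →
      pbN n (fun w => T w / (h - V w.1))
        (fun w => ∑ j ∈ Finset.range (m / 2 + 1),
          (T w / (h - V w.1)) ^ j * Kpart j w) z = 0 := by
  intro z hz
  have hTd : Differentiable ℝ T := hT.differentiable (by simp)
  have hVd : Differentiable ℝ fun w : (Fin n → ℝ) × (Fin n → ℝ) => V w.1 :=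
    (hV.differentiable (by simp)).comp differentiable_fst
  have hKd : ∀ j ∈ Finset.range (m / 2 + 1), Differentiable ℝ (Kpart j) := fun j hj =>
    (hKsmooth j (Nat.lt_succ_iff.mp (Finset.mem_range.mp hj))).differentiable (by simp)
  have hTt : DifferentiableAt ℝ (fun w => T w / (h - V w.1)) z := by
    simpa only [div_eq_mul_inv] using
      (hTd z).fun_mul (((hVd z).const_sub h).fun_inv (sub_ne_zero.mpr hz.symm))
  rw [pbN_sum_pow_mul hTt fun j hj => hKd j hj z]
  simp only [pbN_div_sub (hTd z) (hVd z) hz, mul_left_comm _ (h - V z.1)⁻¹]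
  rw [← Finset.mul_sum, sum_pow_mul_eq_zero_of_pos, mul_zero]
  intro s hs
  obtain ⟨t, ht, rfl⟩ : ∃ t : ℝ, 0 < t ∧ s = (t ^ 2)⁻¹ :=
    ⟨(√s)⁻¹, by positivity, by rw [inv_pow, Real.sq_sqrt hs.le, inv_inv]⟩
  have hzero := congrArg (t * ·) (hcomm (z.1, t • z.2))
  simp only [pbN_add_sum hTd hVd hKd, Finset.mul_sum, mul_zero] at hzero
  have hne : t ^ (m + 2) ≠ 0 := by positivity
  refine (mul_eq_zero_iff_left hne).mp ?_
  rw [← hzero, Finset.mul_sum]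
  refine Finset.sum_congr rfl fun j hj => ?_
  have hj' : j ≤ m / 2 := Nat.lt_succ_iff.mp (Finset.mem_range.mp hj)
  have hTK := mul_pbN_of_scaling hTd (hKd j hj) (fun q p => hThom q p t ht)
    (fun q p => hKhom j hj' q p t ht) z.1 z.2
  have hVK := mul_pbN_of_scaling hVd (hKd j hj) (t := t) (a := 1) (fun q p => by simp)
    (fun q p => hKhom j hj' q p t ht) z.1 z.2
  have hpow : t ^ (m + 2) = t ^ (m - 2 * j) * (t ^ 2) ^ j * t ^ 2 := by
    rw [← pow_mul, ← pow_add, ← pow_add]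
    congr 1
    omega
  rw [mul_add t, hTK, hVK, hpow, inv_pow]
  field_simp
end
end
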